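/- Let u, u′ ∈ (A_r)ⁿ both satisfy coeff_j(u_a) = 0 and coeff_j(u′_a) = 0 for every index a and every j with 0 ≤ j < w_a. Then one has coeff_i(ev_u(f)) = coeff_i(ev_{u′}(f)) for every i with 0 ≤ i ≤ r and every polynomial f ∈ P_{(i)} if and only if coeff_{w_a}(u_a) = coeff_{w_a}(u′_a) for every index a. -/

import Mathlib

open scoped BigOperators

noncomputable section

/-- The truncated polynomial algebra `A_r = ℝ[X]/(X^{r+1})`. -/
abbrev Ar (r : ℕ) : Type :=
  AdjoinRoot ((Polynomial.X : Polynomial ℝ) ^ (r + 1))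

/-- The class `ε` of `X` in `A_r`. -/
noncomputable def eps (r : ℕ) : Ar r :=
  AdjoinRoot.root _

/-- The `j`-th coefficient of an element of `A_r`, via the unique representative of
degree `≤ r`. -/
noncomputable def arCoeff (r j : ℕ) (a : Ar r) : ℝ :=
  (AdjoinRoot.modByMonicHom (Polynomial.monic_X_pow (R := ℝ) (r + 1)) a).coeff j

/-- The ideal `P_{(i)}` of `ℝ[x₁,…,xₙ]` generated by the monomials `x^s` with `w·s ≥ i`. -/
noncomputable def weightedPolyIdeal (n : ℕ) (w : Fin n → ℕ) (i : ℕ) :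
    Ideal (MvPolynomial (Fin n) ℝ) :=
  Ideal.span {p | ∃ s : Fin n → ℕ, i ≤ ∑ a, w a * s a ∧
    p = ∏ a, (MvPolynomial.X a : MvPolynomial (Fin n) ℝ) ^ s a}


open Polynomial in
theorem arCoeff_mk {r j : ℕ} (hj : j ≤ r) (p : ℝ[X]) :
    arCoeff r j (AdjoinRoot.mk _ p) = p.coeff j := by
  rw [arCoeff, AdjoinRoot.modByMonicHom_mk]
  conv_rhs => rw [← Polynomial.modByMonic_add_div p (X ^ (r + 1))]
  rw [coeff_add, coeff_X_pow_mul', if_neg (by omega), add_zero]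

open Polynomial in
/-- An element of `A_r` whose coefficients vanish in degrees `< k` is a multiple of `ε ^ k`. -/
theorem exists_eq_mk_X_pow_mul {r k : ℕ} (hk : k ≤ r) (a : Ar r)
    (ha : ∀ j < k, arCoeff r j a = 0) :
    ∃ q : ℝ[X], a = AdjoinRoot.mk _ (X ^ k * q) ∧ q.coeff 0 = arCoeff r k a := by
  obtain ⟨p, rfl⟩ := AdjoinRoot.mk_surjective a
  obtain ⟨q, rfl⟩ : X ^ k ∣ p := X_pow_dvd_iff.2 fun j hj => by
    rw [← arCoeff_mk (hj.le.trans hk), ha j hj]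
  refine ⟨q, rfl, ?_⟩
  rw [arCoeff_mk hk, coeff_X_pow_mul', if_pos le_rfl, Nat.sub_self]

open Polynomial in
theorem aeval_adjoinRoot_mk {σ : Type*} (g : ℝ[X]) (p : σ → ℝ[X]) (f : MvPolynomial σ ℝ) :
    MvPolynomial.aeval (fun a => AdjoinRoot.mk g (p a)) f =
      AdjoinRoot.mk g (MvPolynomial.aeval p f) :=
  (MvPolynomial.comp_aeval_apply p (AdjoinRoot.mkₐ g) f).symm

open Polynomial in
theorem constantCoeff_aeval {σ : Type*} (p : σ → ℝ[X]) (f : MvPolynomial σ ℝ) :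
    constantCoeff (MvPolynomial.aeval p f) =
      MvPolynomial.eval (fun a => constantCoeff (p a)) f := by
  induction f using MvPolynomial.induction_on with
  | C c => simp [Polynomial.algebraMap_eq]
  | add f g hf hg => rw [map_add, map_add, map_add, hf, hg]
  | mul_X f a hf => rw [map_mul, map_mul, map_mul, hf, MvPolynomial.aeval_X, MvPolynomial.eval_X]

open Polynomial in
/-- Evaluating `f ∈ P_{(i)}` at a family `X ^ w_a * q_a` gives a multiple of `X ^ i`, whose
leading coefficient depends only on the constant coefficients of the `q_a`. -/
theorem aeval_X_pow_mul_of_mem_weightedPolyIdeal {n : ℕ} {w : Fin n → ℕ} {i : ℕ}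
    {q q' : Fin n → ℝ[X]} (hq : ∀ a, constantCoeff (q a) = constantCoeff (q' a))
    {f : MvPolynomial (Fin n) ℝ} (hf : f ∈ weightedPolyIdeal n w i) :
    ∃ h h' : ℝ[X], MvPolynomial.aeval (fun a => X ^ w a * q a) f = X ^ i * h ∧
      MvPolynomial.aeval (fun a => X ^ w a * q' a) f = X ^ i * h' ∧
      constantCoeff h = constantCoeff h' := by
  induction hf using Submodule.span_induction with
  | mem x hx =>
    obtain ⟨s, hs, rfl⟩ := hx
    have key (t : Fin n → ℝ[X]) :
        MvPolynomial.aeval (fun a => X ^ w a * t a)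
          (∏ a, (MvPolynomial.X a : MvPolynomial (Fin n) ℝ) ^ s a) =
        X ^ i * (X ^ (∑ a, w a * s a - i) * ∏ a, t a ^ s a) := by
      rw [← mul_assoc, ← pow_add, Nat.add_sub_cancel' hs]
      simp only [map_prod, map_pow, MvPolynomial.aeval_X, mul_pow, Finset.prod_mul_distrib,
        ← pow_mul, Finset.prod_pow_eq_pow_sum]
    refine ⟨_, _, key q, key q', ?_⟩
    simp only [map_mul, map_prod, map_pow, hq]
  | zero => exact ⟨0, 0, by simp, by simp, rfl⟩
  | add x y _ _ hx hy =>
    obtain ⟨h, h', e, e', eq⟩ := hx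
    obtain ⟨k, k', d, d', dq⟩ := hy
    exact ⟨h + k, h' + k', by rw [map_add, e, d, mul_add], by rw [map_add, e', d', mul_add],
      by rw [map_add, map_add, eq, dq]⟩
  | smul g x _ hx =>
    obtain ⟨h, h', e, e', eq⟩ := hx
    refine ⟨_, _, by rw [smul_eq_mul, map_mul, e, mul_left_comm],
      by rw [smul_eq_mul, map_mul, e', mul_left_comm], ?_⟩
    simp only [map_mul, constantCoeff_aeval, eq, hq]

theorem X_mem_weightedPolyIdeal {n : ℕ} (w : Fin n → ℕ) (a : Fin n) :
    MvPolynomial.X a ∈ weightedPolyIdeal n w (w a) := by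
  refine Ideal.subset_span ⟨Pi.single a 1, ?_, ?_⟩
  · simp [Pi.single_apply]
  · simp [Pi.single_apply]

/-- if `u, u′ ∈ (A_r)ⁿ` both have vanishing coefficients in degrees `< w_a`
in each component, then the evaluations of every `f ∈ P_{(i)}` (for `0 ≤ i ≤ r`) have equal
`i`-th coefficients if and only if `coeff_{w_a}(u_a) = coeff_{w_a}(u′_a)` for all `a`. -/
theorem eval_weightedIdeal_coeff_eq_iff (n r : ℕ) (hr : 1 ≤ r)
    (w : Fin n → ℕ) (hw : ∀ a, w a ≤ r) (u u' : Fin n → Ar r)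
    (hu : ∀ a : Fin n, ∀ j : ℕ, j < w a → arCoeff r j (u a) = 0)
    (hu' : ∀ a : Fin n, ∀ j : ℕ, j < w a → arCoeff r j (u' a) = 0) :
    (∀ i : ℕ, i ≤ r → ∀ f ∈ weightedPolyIdeal n w i,
        arCoeff r i (MvPolynomial.aeval u f) = arCoeff r i (MvPolynomial.aeval u' f)) ↔
      (∀ a : Fin n, arCoeff r (w a) (u a) = arCoeff r (w a) (u' a)) := by
  constructor
  · intro h a
    simpa using h (w a) (hw a) _ (X_mem_weightedPolyIdeal w a)
  · intro h i hi f hf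
    choose q hq hq0 using fun a => exists_eq_mk_X_pow_mul (hw a) (u a) (hu a)
    choose q' hq' hq0' using fun a => exists_eq_mk_X_pow_mul (hw a) (u' a) (hu' a)
    obtain ⟨k, k', e, e', hk⟩ := aeval_X_pow_mul_of_mem_weightedPolyIdeal
      (q := q) (q' := q') (fun a => by
        simp only [Polynomial.constantCoeff_apply, hq0, hq0', h]) hf
    rw [funext hq, funext hq', aeval_adjoinRoot_mk, aeval_adjoinRoot_mk, arCoeff_mk hi,
      arCoeff_mk hi, e, e']
    simpa [Polynomial.coeff_X_pow_mul'] using hk
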